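/- arXiv:2604.20401 — 2 statements merged into one kernel-verified Lean document; each statement's English description precedes it below -/
import Mathlib

section
/- Fix an integer d ≥ 1 and an integer n ≥ 1. The number of finite prefix-closed subsets S of the set of finite sequences over an alphabet of size d (i.e., subsets S ⊆ List (Fin d) such that every prefix of every element of S belongs to S) with exactly n elements equals (1/n)·C(d·n, n−1). -/
/-- Prefix-closed finite sets of words. -/
abbrev PCSet (d : ℕ) : Type :=
  {S : Finset (List (Fin d)) // ∀ l ∈ S, ∀ l' : List (Fin d), l' <+: l → l' ∈ S}

namespace PCSet

variable {d : ℕ}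

/-- The empty prefix-closed set. -/
def nil : PCSet d := ⟨∅, by simp⟩

/-- Joining `d` prefix-closed sets below a new root. -/
def node (f : Fin d → PCSet d) : PCSet d :=
  ⟨insert [] (Finset.univ.biUnion fun i => (f i).1.map ⟨List.cons i, List.cons_injective⟩), by
    intro l hl l' hl'
    cases l' with
    | nil => simp
    | cons i t =>
      obtain ⟨u, rfl⟩ := hl'
      simp at hl ⊢
      exact (f i).2 _ hl _ ⟨u, rfl⟩⟩

theorem cons_mem_node (f : Fin d → PCSet d) (i : Fin d) (t : List (Fin d)) :
    i :: t ∈ (node f).1 ↔ t ∈ (f i).1 := by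
  simp [node]

theorem nil_mem_node (f : Fin d → PCSet d) : [] ∈ (node f).1 := by
  simp [node]

theorem node_injective : Function.Injective (node : (Fin d → PCSet d) → PCSet d) := by
  intro f g h
  funext i
  apply Subtype.ext
  ext t
  rw [← cons_mem_node f, ← cons_mem_node g, h]

theorem card_node (f : Fin d → PCSet d) : (node f).1.card = (∑ i, (f i).1.card) + 1 := by
  unfold node
  rw [Finset.card_insert_of_notMem (by simp), Finset.card_biUnion]
  · simp
  · intro i _ j _ hij
    rw [Function.onFun, Finset.disjoint_left]
    intro a ha hb
    simp at ha hb
    obtain ⟨t, _, rfl⟩ := ha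
    obtain ⟨u, _, h⟩ := hb
    simp at h
    exact hij h.1.symm

theorem eq_nil_or_node (S : PCSet d) : S = nil ∨ ∃ f, S = node f := by
  by_cases h : S.1 = ∅
  · left; exact Subtype.ext h
  · right
    obtain ⟨l, hl⟩ := Finset.nonempty_iff_ne_empty.mpr h
    refine ⟨fun i => ⟨S.1.preimage (List.cons i) List.cons_injective.injOn, ?_⟩, ?_⟩
    · intro l hl l' hl'
      rw [Finset.mem_preimage] at hl ⊢
      exact S.2 _ hl _ ((List.prefix_cons_inj i).2 hl')
    · apply Subtype.ext
      ext t
      cases t with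
      | nil => exact iff_of_true (S.2 _ hl _ List.nil_prefix) (nil_mem_node _)
      | cons i t => rw [cons_mem_node, Finset.mem_preimage]

/-- Forests with `k` components and `n` nodes. -/
def forests (d k n : ℕ) : Set (Fin k → PCSet d) := {f | ∑ i, (f i).1.card = n}

/-- Adding an empty tree in front. -/
def consNil {k : ℕ} (g : Fin k → PCSet d) : Fin (k + 1) → PCSet d := Fin.cons nil g

/-- Joining the last `d` trees and moving the result to the front. -/
def consNode {k : ℕ} (g : Fin (k + d) → PCSet d) : Fin (k + 1) → PCSet d :=
  Fin.cons (node fun i => g (Fin.natAdd k i)) fun i => g (Fin.castAdd d i)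

theorem consNil_injective {k : ℕ} :
    Function.Injective (consNil : (Fin k → PCSet d) → Fin (k + 1) → PCSet d) :=
  fun _ _ h => (Fin.cons_injective2 h).2

theorem consNode_injective {k : ℕ} :
    Function.Injective (consNode : (Fin (k + d) → PCSet d) → Fin (k + 1) → PCSet d) := by
  intro f g h
  obtain ⟨h1, h2⟩ := Fin.cons_injective2 h
  have h1 := node_injective h1
  funext i
  refine Fin.addCases (fun i => ?_) (fun i => ?_) i
  · exact congrFun h2 i
  · exact congrFun h1 i

theorem forests_succ (k n : ℕ) : forests d (k + 1) (n + 1) =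
    consNil '' forests d k (n + 1) ∪ consNode '' forests d (k + d) n := by
  ext f
  simp only [forests, Set.mem_union, Set.mem_image, Set.mem_ofPred_eq]
  constructor
  · intro h
    rw [Fin.sum_univ_succ] at h
    rcases eq_nil_or_node (f 0) with h0 | ⟨g, h0⟩
    · left
      refine ⟨Fin.tail f, ?_, ?_⟩
      · rw [h0] at h
        simpa [nil, Fin.tail] using h
      · rw [consNil, ← h0, Fin.cons_self_tail]
    · right
      refine ⟨Fin.append (Fin.tail f) g, ?_, ?_⟩
      · rw [h0, card_node] at h
        rw [Fin.sum_univ_add]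
        simp only [Fin.append_left, Fin.append_right, Fin.tail]
        omega
      · unfold consNode
        simp only [Fin.append_left, Fin.append_right]
        rw [← h0]
        exact Fin.cons_self_tail f
  · rintro (⟨g, hg, rfl⟩ | ⟨g, hg, rfl⟩)
    · rw [Fin.sum_univ_succ]
      simp only [consNil, Fin.cons_zero, Fin.cons_succ]
      simpa [nil] using hg
    · rw [Fin.sum_univ_add] at hg
      rw [Fin.sum_univ_succ]
      simp only [consNode, Fin.cons_zero, Fin.cons_succ, card_node]
      omega

theorem forests_zero_right (k : ℕ) : forests d k 0 = {fun _ => nil} := by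
  ext f
  simp only [forests, Set.mem_ofPred_eq, Set.mem_singleton_iff, Finset.sum_eq_zero_iff,
    Finset.mem_univ, true_implies, Finset.card_eq_zero]
  constructor
  · intro h; funext i; exact Subtype.ext (h i)
  · rintro rfl i; rfl

theorem forests_zero_left (n : ℕ) : forests d 0 (n + 1) = ∅ := by
  ext f
  simp [forests]

theorem forests_finite (n k : ℕ) : (forests d k n).Finite := by
  induction n generalizing k with
  | zero => rw [forests_zero_right]; exact Set.finite_singleton _
  | succ n ih =>
    induction k with
    | zero => rw [forests_zero_left]; exact Set.finite_empty
    | succ k ihk =>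
      rw [forests_succ]
      exact (ihk.image _).union ((ih _).image _)

theorem ncard_forests_succ (k n : ℕ) : (forests d (k + 1) (n + 1)).ncard =
    (forests d k (n + 1)).ncard + (forests d (k + d) n).ncard := by
  rw [forests_succ, Set.ncard_union_eq _ ((forests_finite _ _).image _)
    ((forests_finite _ _).image _), Set.ncard_image_of_injective _ consNil_injective,
    Set.ncard_image_of_injective _ consNode_injective]
  rw [Set.disjoint_left]
  rintro _ ⟨f, _, rfl⟩ ⟨g, _, h⟩
  have h1 := (Fin.cons_injective2 h).1
  have h2 := nil_mem_node fun i => g (Fin.natAdd k i)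
  rw [h1] at h2
  simp [nil] at h2

end PCSet

theorem forest_recurrence (d : ℕ) (hd : 1 ≤ d) (a : ℕ → ℕ → ℕ) (h0 : ∀ k, a k 0 = 1)
    (h1 : ∀ n, a 0 (n + 1) = 0)
    (h2 : ∀ k n, a (k + 1) (n + 1) = a k (n + 1) + a (k + d) n) (n k : ℕ) :
    (n + 1) * a k (n + 1) = k * (d * (n + 1) + k - 1).choose n := by
  induction n generalizing k with
  | zero =>
    induction k with
    | zero => simp [h1]
    | succ k ih =>
      rw [h2, h0]
      simp at ih ⊢
      exact ih
  | succ n ih =>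
    induction k with
    | zero => simp [h1]
    | succ k ihk =>
      have ihn := ih (k + d)
      rw [h2]
      obtain ⟨M, hM⟩ : ∃ M, d * (n + 1 + 1) + k = M + 1 :=
        ⟨d * (n + 1 + 1) + k - 1, by have : 1 ≤ d * (n + 1 + 1) := Nat.mul_pos hd (by omega); omega⟩
      have e1 : d * (n + 1 + 1) + k - 1 = M := by omega
      have e2 : d * (n + 1) + (k + d) - 1 = M := by
        have : d * (n + 1 + 1) = d * (n + 1) + d := by ring
        omega
      have e3 : d * (n + 1 + 1) + (k + 1) - 1 = M + 1 := by omega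
      rw [e1] at ihk
      rw [e2] at ihn
      rw [e3, Nat.choose_succ_succ]
      have hnM : n ≤ M := by
        have : 1 * (n + 1 + 1) ≤ d * (n + 1 + 1) := Nat.mul_le_mul_right _ hd
        omega
      have hc := Nat.choose_succ_right_eq M n
      zify [hnM] at *
      generalize ((M.choose n : ℕ) : ℤ) = x at *
      generalize ((M.choose (n + 1) : ℕ) : ℤ) = y at *
      have hM' : (M : ℤ) = d * (n + 1 + 1) + k - 1 := by linarith
      rw [hM'] at hc
      have hn : ((n : ℤ) + 1) ≠ 0 := by positivity
      apply mul_left_cancel₀ hn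
      linear_combination ((n : ℤ) + 1) * ihk + ((n : ℤ) + 2) * ihn - hc

/-- The number of finite prefix-closed subsets of `List (Fin d)` (finite sequences
over an alphabet of size `d`) with exactly `n` elements equals the Fuss–Catalan
number `(1/n) * C(d*n, n-1)`. -/
theorem card_prefixClosed_eq_fussCatalan (d n : ℕ) (hd : 1 ≤ d) (hn : 1 ≤ n) :
    ({S : Finset (List (Fin d)) |
        (∀ l ∈ S, ∀ l' : List (Fin d), l' <+: l → l' ∈ S) ∧ S.card = n}.ncard : ℝ) =
      (1 / n) * ((d * n).choose (n - 1)) := by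
  have key : {S : Finset (List (Fin d)) |
        (∀ l ∈ S, ∀ l' : List (Fin d), l' <+: l → l' ∈ S) ∧ S.card = n} =
      (fun f : Fin 1 → PCSet d => (f 0).1) '' PCSet.forests d 1 n := by
    ext S
    simp only [Set.mem_ofPred_eq, Set.mem_image, PCSet.forests, Fin.sum_univ_one]
    constructor
    · rintro ⟨h, hc⟩
      exact ⟨fun _ => ⟨S, h⟩, hc, rfl⟩
    · rintro ⟨f, hc, rfl⟩
      exact ⟨(f 0).2, hc⟩
  rw [key, Set.ncard_image_of_injective]
  · obtain ⟨m, rfl⟩ : ∃ m, n = m + 1 := ⟨n - 1, by omega⟩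
    have h := forest_recurrence d hd (fun k n => (PCSet.forests d k n).ncard)
      (fun k => by simp [PCSet.forests_zero_right]) (fun n => by simp [PCSet.forests_zero_left])
      (fun k n => PCSet.ncard_forests_succ k n) m 1
    simp only [Nat.add_sub_cancel, one_mul] at h ⊢
    rw [← h]
    push_cast
    field_simp
  · intro f g h
    funext i
    rw [Subsingleton.elim i 0]
    exact Subtype.ext h
end

section
/- Fix integers d ≥ 1 and n ≥ 1. The number of finite prefix-closed subsets of the set of finite sequences over an alphabet of size d with exactly n elements is at most (e·d)^n, where e is Euler's number and the inequality is between real numbers. -/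
open Real

/-- Glue `d` subtrees under a common root. -/
def glueTree {d : ℕ} (f : Fin d → Finset (List (Fin d))) : Finset (List (Fin d)) :=
  insert [] (Finset.univ.biUnion fun i => (f i).image (List.cons i))

/-- A finite family containing all prefix-closed sets of height at most `h`. -/
def treeFam (d : ℕ) : ℕ → Finset (Finset (List (Fin d)))
  | 0 => {∅}
  | h + 1 => insert ∅ ((Fintype.piFinset fun _ : Fin d => treeFam d h).image glueTree)

lemma card_glueTree {d : ℕ} (f : Fin d → Finset (List (Fin d))) :
    (glueTree f).card = (∑ i, (f i).card) + 1 := by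
  unfold glueTree
  rw [Finset.card_insert_of_notMem (by simp), Finset.card_biUnion]
  · congr 1
    refine Finset.sum_congr rfl fun i _ => ?_
    exact Finset.card_image_of_injective _ (List.cons_injective)
  · intro i _ j _ hij
    rw [Function.onFun, Finset.disjoint_left]
    intro l hl hl'
    simp only [Finset.mem_image] at hl hl'
    obtain ⟨a, _, rfl⟩ := hl
    obtain ⟨b, _, hb⟩ := hl'
    exact hij (by simpa using (List.cons.inj hb).1.symm)

lemma mem_treeFam {d : ℕ} (h : ℕ) : ∀ S : Finset (List (Fin d)),
    (∀ l ∈ S, ∀ l' : List (Fin d), l' <+: l → l' ∈ S) → (∀ l ∈ S, l.length < h) →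
    S ∈ treeFam d h := by
  induction h with
  | zero =>
    intro S _ hl
    simp only [treeFam, Finset.mem_singleton]
    exact Finset.eq_empty_of_forall_notMem fun l h => absurd (hl l h) (by simp)
  | succ h ih =>
    intro S hS hl
    rw [treeFam, Finset.mem_insert]
    rcases S.eq_empty_or_nonempty with h0 | ⟨l0, hl0⟩
    · exact Or.inl h0
    right
    rw [Finset.mem_image]
    refine ⟨fun i => S.preimage (List.cons i) (List.cons_injective.injOn), ?_, ?_⟩
    · rw [Fintype.mem_piFinset]
      intro i
      apply ih
      · intro l hl l' hll
        rw [Finset.mem_preimage] at hl ⊢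
        exact hS _ hl _ (by simpa using hll)
      · intro l hm
        rw [Finset.mem_preimage] at hm
        simpa using hl _ hm
    · ext l
      cases l with
      | nil => simpa [glueTree] using hS _ hl0 [] (List.nil_prefix)
      | cons a l => simp [glueTree]

lemma sum_treeFam_le {d : ℕ} (x c : ℝ) (hx : 0 ≤ x) (hc : 1 + x * c ^ d ≤ c) (hc0 : 1 ≤ c)
    (h : ℕ) : ∑ S ∈ treeFam d h, x ^ S.card ≤ c := by
  classical
  induction h with
  | zero => simpa [treeFam] using hc0
  | succ h ih =>
    rw [treeFam, Finset.sum_insert (by simp [glueTree])]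
    have h1 : ∑ S ∈ (Fintype.piFinset fun _ : Fin d => treeFam d h).image glueTree, x ^ S.card
        ≤ ∑ f ∈ Fintype.piFinset fun _ : Fin d => treeFam d h, x ^ (glueTree f).card :=
      Finset.sum_image_le_of_nonneg (fun _ _ => by positivity)
    have h2 : ∑ f ∈ Fintype.piFinset (fun _ : Fin d => treeFam d h), x ^ (glueTree f).card
        = x * (∑ S ∈ treeFam d h, x ^ S.card) ^ d := by
      have := Finset.prod_univ_sum (fun _ : Fin d => treeFam d h)
        (fun _ (S : Finset (List (Fin d))) => x ^ S.card)
      rw [Finset.prod_const, Finset.card_univ, Fintype.card_fin] at this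
      rw [this, Finset.mul_sum]
      refine Finset.sum_congr rfl fun f _ => ?_
      rw [card_glueTree, pow_succ, Finset.prod_pow_eq_pow_sum, mul_comm]
    have h3 : (∑ S ∈ treeFam d h, x ^ S.card) ^ d ≤ c ^ d :=
      pow_le_pow_left₀ (Finset.sum_nonneg fun _ _ => by positivity) ih d
    have h4 := mul_le_mul_of_nonneg_left h3 hx
    simp only [Finset.card_empty, pow_zero]
    linarith

/-- The number of finite prefix-closed subsets of `List (Fin d)` (finite sequences
over an alphabet of size `d`) with exactly `n` elements is at most `(e*d)^n`. -/
theorem card_prefixClosed_le_exp_mul_pow (d n : ℕ) (hd : 1 ≤ d) (hn : 1 ≤ n) :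
    ({S : Finset (List (Fin d)) |
        (∀ l ∈ S, ∀ l' : List (Fin d), l' <+: l → l' ∈ S) ∧ S.card = n}.ncard : ℝ) ≤
      (Real.exp 1 * d) ^ n := by
  classical
  have hd' : (1 : ℝ) ≤ d := by exact_mod_cast hd
  have hd0 : (0 : ℝ) < d := by linarith
  set A := {S : Finset (List (Fin d)) |
        (∀ l ∈ S, ∀ l' : List (Fin d), l' <+: l → l' ∈ S) ∧ S.card = n} with hA
  by_cases hfin : A.Finite
  swap
  · rw [Set.Infinite.ncard hfin]
    simp only [Nat.cast_zero]
    positivity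
  rw [Set.ncard_eq_toFinset_card A hfin]
  set B := hfin.toFinset with hB
  have hBm : ∀ S ∈ B, (∀ l ∈ S, ∀ l' : List (Fin d), l' <+: l → l' ∈ S) ∧ S.card = n := by
    intro S hS
    exact hfin.mem_toFinset.1 hS
  set h := B.sup (fun S => S.sup fun l => l.length + 1) with hh
  set x : ℝ := (Real.exp 1 * d)⁻¹ with hx
  have hx0 : 0 < x := by positivity
  have hcd : (1 + 1 / (d : ℝ)) ^ d ≤ Real.exp 1 := by
    have h1 : 1 + 1 / (d : ℝ) ≤ Real.exp (1 / d) := by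
      have := Real.add_one_le_exp (1 / (d : ℝ)); linarith
    calc (1 + 1 / (d : ℝ)) ^ d ≤ (Real.exp (1 / d)) ^ d :=
          pow_le_pow_left₀ (by positivity) h1 d
      _ = Real.exp 1 := by
          rw [← Real.exp_nat_mul]; congr 1; field_simp
  have hkey := sum_treeFam_le (d := d) x (1 + 1 / d) hx0.le (by
    have := mul_le_mul_of_nonneg_left hcd hx0.le
    have h2 : x * Real.exp 1 = 1 / d := by
      rw [hx]; field_simp
    linarith) (by have : (0:ℝ) ≤ 1 / d := by positivity
                  linarith) h
  have hempty : ∅ ∉ B := fun h0 => by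
    have := (hBm _ h0).2
    simp at this
    omega
  have hsub : insert ∅ B ⊆ treeFam d h := by
    intro S hS
    rcases Finset.mem_insert.1 hS with rfl | hS
    · exact mem_treeFam h ∅ (by simp) (by simp)
    · refine mem_treeFam h S (hBm S hS).1 fun l hl => ?_
      have h1 : l.length + 1 ≤ S.sup fun l => l.length + 1 :=
        Finset.le_sup (f := fun l : List (Fin d) => l.length + 1) hl
      have h2 : (S.sup fun l => l.length + 1) ≤ h :=
        Finset.le_sup (f := fun S : Finset (List (Fin d)) => S.sup fun l => l.length + 1) hS
      omega
  have h5 := Finset.sum_le_sum_of_subset_of_nonneg (f := fun S => x ^ S.card) hsub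
    (fun _ _ _ => by positivity)
  rw [Finset.sum_insert hempty, Finset.sum_congr rfl (fun S hS => by rw [(hBm S hS).2]),
    Finset.sum_const, nsmul_eq_mul] at h5
  simp only [Finset.card_empty, pow_zero] at h5
  have h6 : 1 / (d : ℝ) ≤ 1 := by rw [div_le_one hd0]; exact hd'
  have h7 : (B.card : ℝ) * x ^ n ≤ 1 := by linarith
  rw [hx, inv_pow, ← div_eq_mul_inv, div_le_one (by positivity)] at h7
  exact h7
end
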